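/- arXiv:2210.04059 — 3 statements merged into one kernel-verified Lean document; each statement's English description precedes it below -/
import Mathlib

section
/- Let n be a positive integer, v_1,…,v_n ≥ 0, and q_1,…,q_n ∈ [0,1] with Σ_{i=1}^n q_i ≤ 1. Let X_1,…,X_n be independent Bernoulli random variables with P(X_i = 1) = q_i, and let D̃ = {i : X_i = 1}. Then E[max_{i∈D̃} v_i] ≥ (1 − 1/e) Σ_{i=1}^n v_i q_i, where the maximum over the empty set is defined to be 0. -/
open Finset

/-- The probability that the set of `1`-coordinates of a vector of independent Bernoulli
random variables with means `p` equals exactly `A`. -/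
noncomputable def bernWeight {n : ℕ} (p : Fin n → ℝ) (A : Finset (Fin n)) : ℝ :=
  (∏ i ∈ A, p i) * ∏ i ∈ Aᶜ, (1 - p i)

theorem bernWeight_nonneg {n : ℕ} {q : Fin n → ℝ} (hq : ∀ i, q i ∈ Set.Icc (0:ℝ) 1)
    (A : Finset (Fin n)) : 0 ≤ bernWeight q A :=
  mul_nonneg (prod_nonneg fun i _ => (hq i).1) (prod_nonneg fun i _ => sub_nonneg.2 (hq i).2)

theorem sum_bernWeight {n : ℕ} (q : Fin n → ℝ) : ∑ A, bernWeight q A = 1 := by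
  have h := prod_add q (fun i => 1 - q i) univ
  simpa [bernWeight, compl_eq_univ_sdiff] using h.symm

/-- The random set avoids `T` with probability `∏ i ∈ T, (1 - q i)`. -/
theorem sum_bernWeight_disjoint {n : ℕ} (q : Fin n → ℝ) (T : Finset (Fin n)) :
    ∑ A, bernWeight q A * (if Disjoint A T then 1 else 0) = ∏ i ∈ T, (1 - q i) := by
  have h := prod_add (fun i => if i ∈ T then 0 else q i) (fun i => 1 - q i) univ
  have hl : ∏ i, ((if i ∈ T then 0 else q i) + (1 - q i)) = ∏ i ∈ T, (1 - q i) := by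
    rw [← prod_subset (subset_univ T)]
    · exact prod_congr rfl fun i hi => by simp [hi]
    · intro i _ hi
      simp [hi]
  rw [← hl, h, powerset_univ]
  refine sum_congr rfl fun A _ => ?_
  rw [bernWeight, compl_eq_univ_sdiff]
  by_cases hA : Disjoint A T
  · have : ∏ i ∈ A, (if i ∈ T then 0 else q i) = ∏ i ∈ A, q i :=
      prod_congr rfl fun i hi => by simp [disjoint_left.1 hA hi]
    simp [hA, this]
  · obtain ⟨i, hi, hiT⟩ := not_disjoint_iff.1 hA
    have : ∏ i ∈ A, (if i ∈ T then 0 else q i) = 0 := prod_eq_zero hi (by simp [hiT])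
    simp [hA, this]

/-- The concave function `x ↦ 1 - exp (-x)` lies above its chord on `[0, 1]`. -/
theorem one_sub_inv_exp_mul_le {x : ℝ} (h0 : 0 ≤ x) (h1 : x ≤ 1) :
    (1 - (Real.exp 1)⁻¹) * x ≤ 1 - Real.exp (-x) := by
  have h := convexOn_exp.2 (Set.mem_univ (0:ℝ)) (Set.mem_univ (-1:ℝ)) (sub_nonneg.2 h1) h0
    (sub_add_cancel 1 x)
  simp only [smul_eq_mul, mul_zero, zero_add, mul_neg, mul_one, Real.exp_zero, Real.exp_neg 1] at h
  linarith

/-- The random set meets `T` with probability at least `(1 - 1/e) ∑ i ∈ T, q i`. -/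
theorem le_sum_bernWeight_not_disjoint {n : ℕ} {q : Fin n → ℝ}
    (hq : ∀ i, q i ∈ Set.Icc (0:ℝ) 1) (hq1 : ∑ i, q i ≤ 1) (T : Finset (Fin n)) :
    (1 - (Real.exp 1)⁻¹) * ∑ i ∈ T, q i
      ≤ ∑ A, bernWeight q A * (if Disjoint A T then 0 else 1) := by
  have hsum : ∑ A, bernWeight q A * (if Disjoint A T then 0 else 1)
      = 1 - ∏ i ∈ T, (1 - q i) := by
    rw [← sum_bernWeight_disjoint, eq_sub_iff_add_eq, ← sum_add_distrib]
    refine (sum_congr rfl fun A _ => ?_).trans (sum_bernWeight q)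
    split_ifs <;> ring
  have hprod : ∏ i ∈ T, (1 - q i) ≤ Real.exp (-∑ i ∈ T, q i) := by
    rw [← sum_neg_distrib, Real.exp_sum]
    exact prod_le_prod (fun i _ => sub_nonneg.2 (hq i).2) fun i _ => Real.one_sub_le_exp_neg _
  have hle : ∑ i ∈ T, q i ≤ 1 :=
    (sum_le_sum_of_subset_of_nonneg (subset_univ T) fun i _ _ => (hq i).1).trans hq1
  have h := one_sub_inv_exp_mul_le (sum_nonneg fun i (_ : i ∈ T) => (hq i).1) hle
  linarith

theorem le_biSup_of_mem {n : ℕ} (v : Fin n → ℝ) {A : Finset (Fin n)} {i : Fin n} (hi : i ∈ A) :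
    v i ≤ ⨆ i ∈ A, v i := by
  have h := le_ciSup (f := fun i => ⨆ _ : i ∈ A, v i) (Set.finite_range _).bddAbove i
  simpa [hi] using h

theorem biSup_le_of_nonneg {n : ℕ} {v : Fin n → ℝ} {A : Finset (Fin n)} {c : ℝ} (hc : 0 ≤ c)
    (h : ∀ i ∈ A, v i ≤ c) : ⨆ i ∈ A, v i ≤ c :=
  Real.iSup_le (fun i => Real.iSup_le (h i) hc) hc

theorem biSup_nonneg_of_nonneg {n : ℕ} {v : Fin n → ℝ} (hv : ∀ i, 0 ≤ v i) (A : Finset (Fin n)) :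
    0 ≤ ⨆ i ∈ A, v i :=
  Real.iSup_nonneg fun i => Real.iSup_nonneg fun _ => hv i

/-- Subtracting a constant `m` on the support `T` of `v` lowers the maximum by at least `m`
whenever the set meets `T`. -/
theorem mul_add_biSup_le {n : ℕ} {v : Fin n → ℝ} (hv : ∀ i, 0 ≤ v i) {T : Finset (Fin n)} {m : ℝ}
    (hm : ∀ i ∈ T, m ≤ v i) (A : Finset (Fin n)) :
    m * (if Disjoint A T then 0 else 1) + ⨆ i ∈ A, (if i ∈ T then v i - m else 0)
      ≤ ⨆ i ∈ A, v i := by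
  split_ifs with hA
  · rw [mul_zero, zero_add]
    refine biSup_le_of_nonneg (biSup_nonneg_of_nonneg hv A) fun i hi => ?_
    rw [if_neg (disjoint_left.1 hA hi)]
    exact biSup_nonneg_of_nonneg hv A
  · obtain ⟨j, hj, hjT⟩ := not_disjoint_iff.1 hA
    have hmA : 0 ≤ (⨆ i ∈ A, v i) - m := sub_nonneg.2 ((hm j hjT).trans (le_biSup_of_mem v hj))
    have h : ⨆ i ∈ A, (if i ∈ T then v i - m else 0) ≤ (⨆ i ∈ A, v i) - m := by
      refine biSup_le_of_nonneg hmA fun i hi => ?_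
      split_ifs
      · exact sub_le_sub_right (le_biSup_of_mem v hi) m
      · exact hmA
    linarith

/-- **Correlation-gap bound for a single offering list (Lemma: list_bound).**
If `X_i` are independent Bernoulli with means `q i` and `∑ q i ≤ 1`, then for nonnegative
values `v`, `E[max_{i ∈ D̃} v i] ≥ (1 − 1/e) ∑ v i * q i`, where `D̃ = {i : X_i = 1}`
and the max over the empty set is `0`. -/
theorem stmt4 (n : ℕ) (hn : 0 < n) (v q : Fin n → ℝ) (hv : ∀ i, 0 ≤ v i)
    (hq : ∀ i, q i ∈ Set.Icc (0:ℝ) 1) (hq1 : ∑ i, q i ≤ 1) :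
    ∑ A : Finset (Fin n), bernWeight q A * (⨆ i ∈ A, v i)
      ≥ (1 - (Real.exp 1)⁻¹) * ∑ i, v i * q i := by
  induction hk : #{i | 0 < v i} using Nat.strong_induction_on generalizing v with
  | _ k ih =>
  set T : Finset (Fin n) := {i | 0 < v i} with hT
  have hvT : ∀ i ∉ T, v i = 0 := fun i hi =>
    le_antisymm (not_lt.1 fun h => hi (by simpa [hT] using h)) (hv i)
  rcases T.eq_empty_or_nonempty with hemp | hne
  · have h0 : ∀ i, v i = 0 := fun i => hvT i (by simp [hemp])
    simp [h0]
  obtain ⟨j, hjT, hj⟩ := exists_min_image T v hne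
  have hw : ∀ i, 0 ≤ if i ∈ T then v i - v j else 0 := fun i => by
    split_ifs with hi
    · exact sub_nonneg.2 (hj i hi)
    · exact le_rfl
  have hlt : #{i | 0 < if i ∈ T then v i - v j else 0} < k := by
    rw [← hk]
    refine card_lt_card ⟨fun i hi => ?_, fun hsub => ?_⟩
    · by_contra hiT
      simp [hiT] at hi
    · simpa using hsub hjT
  have hrec := ih _ hlt _ hw rfl
  have hmeet := mul_le_mul_of_nonneg_left (le_sum_bernWeight_not_disjoint hq hq1 T) (hv j)
  have hsplit : ∑ i, v i * q i
      = v j * ∑ i ∈ T, q i + ∑ i, (if i ∈ T then v i - v j else 0) * q i := by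
    rw [mul_sum, ← sum_subset (subset_univ T) fun i _ hi => by simp [hvT i hi],
      ← sum_subset (subset_univ T) fun i _ hi => by simp [hi], ← sum_add_distrib]
    refine sum_congr rfl fun i hi => ?_
    rw [if_pos hi]
    ring
  have hmax := sum_le_sum fun A (_ : A ∈ univ) =>
    mul_le_mul_of_nonneg_left (mul_add_biSup_le hv hj A) (bernWeight_nonneg hq A)
  simp only [mul_add, sum_add_distrib, mul_left_comm _ (v j), ← mul_sum] at hmax
  rw [hsplit]
  linarith
end

section
/- Fix an integer k ≥ 1, τ ∈ (0,1), an integer n ≥ 1, probabilities p_1,…,p_n ∈ [0,1] and values v_1 ≥ v_2 ≥ ⋯ ≥ v_n ≥ τ. Define LP_sim as the supremum over y ∈ [0,1]^n of Σ_{i=1}^n v_i p_i y_i + min(0, k − Σ_{i=1}^n p_i y_i), and define α_k^τ = sup_{0 ≤ s ≤ 1} (s − s/τ + E[min(Pois(sk), k)]/(τk)), where for λ ≥ 0, E[min(Pois(λ), k)] denotes Σ_{j=0}^∞ min(j, k) e^{−λ} λ^j / j!. Then there exists a threshold vector y′ ∈ [0,1]^n (i.e., there is an index j with y′_i = 1 for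 i < j and y′_i = 0 for i > j) such that, with D′_1,…,D′_n independent Bernoulli random variables with P(D′_i = 1) = y′_i p_i, one has Σ_{i=1}^n v_i y′_i p_i − E[max(Σ_{i=1}^n D′_i − k, 0)] ≥ α_k^τ · LP_sim. -/
open Finset

/-- `E[min(Pois(λ), k)] = ∑_{j=0}^∞ min(j,k) e^{−λ} λ^j / j!`. -/
noncomputable def poisMin (k : ℕ) (lam : ℝ) : ℝ :=
  ∑' j : ℕ, min (j : ℝ) (k : ℝ) * (Real.exp (-lam) * lam ^ j / (Nat.factorial j : ℝ))

/-- The value of the simultaneous-offering LP relaxation `LP_sim`. -/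
noncomputable def lpSim (n k : ℕ) (p v : Fin n → ℝ) : ℝ :=
  sSup {z : ℝ | ∃ y : Fin n → ℝ, (∀ i, y i ∈ Set.Icc (0:ℝ) 1) ∧
    z = ∑ i, v i * p i * y i + min 0 ((k:ℝ) - ∑ i, p i * y i)}

/-- The probability that a Poisson variable of mean `x` equals `j`. -/
noncomputable def poisMass (j : ℕ) (x : ℝ) : ℝ := Real.exp (-x) * x ^ j / (Nat.factorial j : ℝ)

/-- The probability that a Poisson variable of mean `x` is less than `k`. -/
noncomputable def poisCdf (k : ℕ) (x : ℝ) : ℝ := ∑ j ∈ range k, poisMass j x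

/-- The expected shortfall `E[max(k - Pois(x), 0)]`. -/
noncomputable def poisShortfall (k : ℕ) (x : ℝ) : ℝ := ∑ i ∈ range k, poisCdf (i + 1) x

lemma poisMass_nonneg (j : ℕ) {x : ℝ} (hx : 0 ≤ x) : 0 ≤ poisMass j x := by
  unfold poisMass; positivity

lemma poisCdf_succ_zero (k : ℕ) : poisCdf (k + 1) 0 = 1 := by
  simp [poisCdf, poisMass, sum_range_succ']

lemma poisShortfall_zero (k : ℕ) : poisShortfall k 0 = k := by
  simp [poisShortfall, poisCdf_succ_zero]

lemma poisShortfall_succ (k : ℕ) (x : ℝ) :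
    poisShortfall (k + 1) x = poisShortfall k x + poisCdf (k + 1) x :=
  sum_range_succ _ _

lemma hasDerivAt_poisMass_zero (x : ℝ) : HasDerivAt (poisMass 0) (-poisMass 0 x) x := by
  have h : poisMass 0 = fun x => Real.exp (-x) := by
    ext y
    simp [poisMass]
  rw [h]
  simpa using (hasDerivAt_neg x).exp

lemma hasDerivAt_poisMass_succ (j : ℕ) (x : ℝ) :
    HasDerivAt (poisMass (j + 1)) (poisMass j x - poisMass (j + 1) x) x := by
  have h := (((hasDerivAt_neg x).exp).mul (hasDerivAt_pow (j + 1) x)).div_const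
    ((Nat.factorial (j + 1) : ℕ) : ℝ)
  refine h.congr_deriv ?_
  have hj : (Nat.factorial j : ℝ) ≠ 0 := by positivity
  have hj' : (j : ℝ) + 1 ≠ 0 := by positivity
  simp only [poisMass, Nat.factorial_succ]
  push_cast
  field_simp
  ring

lemma hasDerivAt_poisCdf_succ (k : ℕ) (x : ℝ) :
    HasDerivAt (poisCdf (k + 1)) (-poisMass k x) x := by
  induction k with
  | zero =>
    have h : poisCdf (0 + 1) = poisMass 0 := by
      ext y
      simp [poisCdf]
    rw [h]
    exact hasDerivAt_poisMass_zero x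
  | succ k ih =>
    have h : poisCdf (k + 1 + 1) = fun y => poisCdf (k + 1) y + poisMass (k + 1) y := by
      ext y
      exact sum_range_succ _ _
    rw [h]
    exact (ih.add (hasDerivAt_poisMass_succ k x)).congr_deriv (by ring)

lemma hasDerivAt_poisShortfall (k : ℕ) (x : ℝ) :
    HasDerivAt (poisShortfall k) (-poisCdf k x) x := by
  have h := HasDerivAt.fun_sum (u := range k) fun i _ => hasDerivAt_poisCdf_succ i x
  refine h.congr_deriv ?_
  simp [poisCdf]

lemma antitoneOn_poisCdf (k : ℕ) : AntitoneOn (poisCdf k) (Set.Ici 0) := by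
  cases k with
  | zero =>
    intro x _ y _ _
    simp [poisCdf]
  | succ k =>
    refine antitoneOn_of_hasDerivWithinAt_nonpos (convex_Ici 0)
      (fun x _ => (hasDerivAt_poisCdf_succ k x).continuousAt.continuousWithinAt)
      (fun x _ => (hasDerivAt_poisCdf_succ k x).hasDerivWithinAt) fun x hx => ?_
    rw [interior_Ici] at hx
    exact neg_nonpos.2 (poisMass_nonneg k (le_of_lt hx))

lemma antitoneOn_poisShortfall (k : ℕ) : AntitoneOn (poisShortfall k) (Set.Ici 0) :=
  fun _ hx _ hy hxy => sum_le_sum fun i _ => antitoneOn_poisCdf (i + 1) hx hy hxy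

lemma convexOn_poisShortfall (k : ℕ) : ConvexOn ℝ (Set.Ici 0) (poisShortfall k) := by
  have hd : deriv (poisShortfall k) = fun x => -poisCdf k x :=
    funext fun x => (hasDerivAt_poisShortfall k x).deriv
  refine MonotoneOn.convexOn_of_deriv (convex_Ici 0)
    (fun x _ => (hasDerivAt_poisShortfall k x).continuousAt.continuousWithinAt)
    (fun x _ => (hasDerivAt_poisShortfall k x).differentiableAt.differentiableWithinAt) ?_
  rw [hd]
  exact ((antitoneOn_poisCdf k).mono interior_subset).neg

lemma poisShortfall_tangent (k : ℕ) {x q : ℝ} (hx : 0 ≤ x) (hq : 0 ≤ q) :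
    poisShortfall k x - q * poisCdf k x ≤ poisShortfall k (x + q) := by
  rcases hq.eq_or_lt with rfl | hq
  · simp
  · have h := (convexOn_poisShortfall k).le_slope_of_hasDerivAt (x := x) (y := x + q) hx
      (by simp only [Set.mem_Ici]; linarith) (by linarith) (hasDerivAt_poisShortfall k x)
    rw [slope_def_field, add_sub_cancel_left, le_div_iff₀ hq] at h
    linarith

lemma poisShortfall_bernoulli_step (k : ℕ) {x q : ℝ} (hx : 0 ≤ x) (hq : 0 ≤ q) :
    (1 - q) * poisShortfall k x + q * poisShortfall (k - 1) x ≤ poisShortfall k (x + q) := by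
  refine le_trans (le_of_eq ?_) (poisShortfall_tangent k hx hq)
  cases k with
  | zero => simp [poisShortfall, poisCdf]
  | succ k =>
    rw [Nat.add_sub_cancel, poisShortfall_succ]
    ring

lemma le_poisShortfall_add (k : ℕ) {x : ℝ} (hx : 0 ≤ x) : (k : ℝ) ≤ poisShortfall k x + x := by
  have h := poisShortfall_tangent k le_rfl hx
  rw [zero_add, poisShortfall_zero] at h
  cases k with
  | zero => simpa [poisShortfall] using hx
  | succ k =>
    rw [poisCdf_succ_zero] at h
    linarith

lemma hasSum_poisMass (x : ℝ) : HasSum (fun j => poisMass j x) 1 := by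
  have h := (NormedSpace.expSeries_div_hasSum_exp (𝔸 := ℝ) x).mul_left (Real.exp (-x))
  rw [← congrFun Real.exp_eq_exp_ℝ x, ← Real.exp_add, neg_add_cancel, Real.exp_zero] at h
  simpa only [poisMass, mul_div_assoc] using h

lemma hasSum_min_mul_poisMass (k : ℕ) (x : ℝ) :
    HasSum (fun j : ℕ => min (j : ℝ) (k : ℝ) * poisMass j x) (k - poisShortfall k x) := by
  induction k with
  | zero => simp [poisShortfall]
  | succ k ih =>
    have hfin : HasSum (fun j => if j ∈ range (k + 1) then poisMass j x else 0)
        (poisCdf (k + 1) x) := by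
      have h := hasSum_sum_of_ne_finset_zero (L := .unconditional ℕ) (s := range (k + 1))
        (f := fun j => if j ∈ range (k + 1) then poisMass j x else 0)
        (fun j hj => if_neg hj)
      rwa [sum_ite_mem, inter_self] at h
    have h := ih.add ((hasSum_poisMass x).sub hfin)
    convert h using 1
    · ext j
      by_cases hj : j ∈ range (k + 1)
      · have hjk : (j : ℝ) ≤ k := by exact_mod_cast Nat.lt_succ_iff.1 (mem_range.1 hj)
        rw [if_pos hj, min_eq_left hjk, min_eq_left (by push_cast; linarith)]
        ring
      · have hjk : ((k + 1 : ℕ) : ℝ) ≤ j := by exact_mod_cast not_lt.1 (mt mem_range.2 hj)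
        rw [if_neg hj, min_eq_right hjk, min_eq_right (by push_cast at hjk; linarith)]
        push_cast
        ring
    · rw [poisShortfall_succ]
      push_cast
      ring

lemma poisMin_eq (k : ℕ) (x : ℝ) : poisMin k x = k - poisShortfall k x :=
  (hasSum_min_mul_poisMass k x).tsum_eq

lemma mul_poisMin_le {k : ℕ} {c x : ℝ} (hc : c ∈ Set.Icc (0 : ℝ) 1) (hx : 0 ≤ x) :
    c * poisMin k x ≤ poisMin k (c * x) := by
  have h := (convexOn_poisShortfall k).2 (x := x) (y := 0) hx (Set.mem_Ici.2 le_rfl) hc.1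
    (sub_nonneg.2 hc.2) (by ring)
  simp only [smul_eq_mul, mul_zero, add_zero, poisShortfall_zero] at h
  rw [poisMin_eq, poisMin_eq]
  linarith

section BernoulliSums

variable {ι : Type*} [DecidableEq ι]

lemma sum_powerset_insert_bernoulli (q : ι → ℝ) (f : Finset ι → ℝ) {a : ι} {S : Finset ι}
    (ha : a ∉ S) :
    ∑ A ∈ (insert a S).powerset, ((∏ i ∈ A, q i) * ∏ i ∈ insert a S \ A, (1 - q i)) * f A =
      ∑ A ∈ S.powerset, ((∏ i ∈ A, q i) * ∏ i ∈ S \ A, (1 - q i)) *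
        ((1 - q a) * f A + q a * f (insert a A)) := by
  rw [sum_powerset_insert ha, ← sum_add_distrib]
  refine sum_congr rfl fun A hA => ?_
  have haA : a ∉ A := fun h => ha (mem_powerset.1 hA h)
  rw [prod_insert haA, insert_sdiff_of_notMem _ haA, insert_sdiff_insert,
    sdiff_insert_of_notMem ha, prod_insert (fun h => ha (mem_sdiff.1 h).1)]
  ring

lemma sum_powerset_bernoulli (q : ι → ℝ) (S : Finset ι) :
    ∑ A ∈ S.powerset, ((∏ i ∈ A, q i) * ∏ i ∈ S \ A, (1 - q i)) = 1 := by
  rw [← prod_add]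
  simp

lemma sum_powerset_bernoulli_mul_card (q : ι → ℝ) (S : Finset ι) :
    ∑ A ∈ S.powerset, ((∏ i ∈ A, q i) * ∏ i ∈ S \ A, (1 - q i)) * (A.card : ℝ) =
      ∑ i ∈ S, q i := by
  induction S using Finset.induction_on with
  | empty => simp
  | insert a S ha ih =>
    have hqa : q a = ∑ A ∈ S.powerset, ((∏ i ∈ A, q i) * ∏ i ∈ S \ A, (1 - q i)) * q a := by
      rw [← sum_mul, sum_powerset_bernoulli, one_mul]
    rw [sum_powerset_insert_bernoulli q _ ha, sum_insert ha, ← ih, hqa, ← sum_add_distrib, ← hqa]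
    refine sum_congr rfl fun A hA => ?_
    rw [card_insert_of_notMem fun h => ha (mem_powerset.1 hA h)]
    push_cast
    ring

lemma sum_powerset_bernoulli_mul_poisShortfall_le (q : ι → ℝ)
    (hq : ∀ i, q i ∈ Set.Icc (0 : ℝ) 1) (S : Finset ι) (k : ℕ) :
    ∀ x : ℝ, 0 ≤ x →
      ∑ A ∈ S.powerset, ((∏ i ∈ A, q i) * ∏ i ∈ S \ A, (1 - q i)) *
        poisShortfall (k - A.card) x ≤ poisShortfall k (x + ∑ i ∈ S, q i) := by
  induction S using Finset.induction_on with
  | empty => simp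
  | insert a S ha ih =>
    intro x hx
    rw [sum_powerset_insert_bernoulli q _ ha, sum_insert ha, ← add_assoc]
    refine le_trans (sum_le_sum fun A hA => ?_) (ih (x + q a) (add_nonneg hx (hq a).1))
    refine mul_le_mul_of_nonneg_left ?_ (mul_nonneg (prod_nonneg fun i _ => (hq i).1)
      (prod_nonneg fun i _ => sub_nonneg.2 (hq i).2))
    rw [card_insert_of_notMem fun h => ha (mem_powerset.1 hA h), ← Nat.sub_sub]
    exact poisShortfall_bernoulli_step _ hx (hq a).1

end BernoulliSums

/-- The expected excess over `k` of a sum of independent Bernoulli variables is at most that of a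
Poisson variable with the same mean. -/
lemma sum_bernWeight_mul_excess_le {n : ℕ} (q : Fin n → ℝ) (hq : ∀ i, q i ∈ Set.Icc (0 : ℝ) 1)
    (k : ℕ) :
    ∑ A : Finset (Fin n), bernWeight q A * max ((A.card : ℝ) - k) 0 ≤
      ∑ i, q i - poisMin k (∑ i, q i) := by
  have h := sum_powerset_bernoulli_mul_poisShortfall_le q hq univ k 0 le_rfl
  have h1 := sum_powerset_bernoulli q univ
  have hcard := sum_powerset_bernoulli_mul_card q univ
  simp only [powerset_univ, ← compl_eq_univ_sdiff, zero_add, poisShortfall_zero] at h h1 hcard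
  have hsplit : ∀ A : Finset (Fin n), bernWeight q A * max ((A.card : ℝ) - k) 0 =
      ((∏ i ∈ A, q i) * ∏ i ∈ Aᶜ, (1 - q i)) * (A.card : ℝ) -
        k * ((∏ i ∈ A, q i) * ∏ i ∈ Aᶜ, (1 - q i)) +
        ((∏ i ∈ A, q i) * ∏ i ∈ Aᶜ, (1 - q i)) * ((k - A.card : ℕ) : ℝ) := by
    intro A
    have hmax : max ((A.card : ℝ) - k) 0 = A.card - k + ((k - A.card : ℕ) : ℝ) := by
      rcases le_total k A.card with hk | hk
      · have hk' : (k : ℝ) ≤ A.card := by exact_mod_cast hk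
        rw [Nat.sub_eq_zero_of_le hk, max_eq_left (sub_nonneg.2 hk')]
        simp
      · have hk' : (A.card : ℝ) ≤ k := by exact_mod_cast hk
        rw [Nat.cast_sub hk, max_eq_right (sub_nonpos.2 hk')]
        ring
    rw [hmax, bernWeight]
    ring
  rw [sum_congr rfl fun A _ => hsplit A, sum_add_distrib, sum_sub_distrib, ← mul_sum, h1, hcard,
    poisMin_eq]
  linarith

/-- The threshold vector that accepts the first `t` candidates, the last one fractionally. -/
noncomputable def thresholdVec (n : ℕ) (t : ℝ) (i : Fin n) : ℝ := max 0 (min 1 (t - i))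

/-- The expected reward of the randomized policy that offers to `i` with probability `y i`. -/
noncomputable def simReward {n : ℕ} (k : ℕ) (p v y : Fin n → ℝ) : ℝ :=
  (∑ i, v i * (y i * p i)) -
    ∑ A : Finset (Fin n), bernWeight (fun i => y i * p i) A * max ((A.card : ℝ) - (k : ℝ)) 0

lemma thresholdVec_mem (n : ℕ) (t : ℝ) (i : Fin n) : thresholdVec n t i ∈ Set.Icc (0 : ℝ) 1 :=
  ⟨le_max_left _ _, max_le zero_le_one (min_le_left _ _)⟩

lemma continuous_thresholdVec (n : ℕ) (i : Fin n) : Continuous fun t => thresholdVec n t i := by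
  unfold thresholdVec
  fun_prop

lemma exists_threshold_index {n : ℕ} (hn : 0 < n) {t : ℝ} (ht : t ∈ Set.Icc (0 : ℝ) n) :
    ∃ j : Fin n, (∀ i, i < j → thresholdVec n t i = 1) ∧ ∀ i, j < i → thresholdVec n t i = 0 := by
  have hfloor := Nat.floor_le ht.1
  refine ⟨⟨min ⌊t⌋₊ (n - 1), by omega⟩, fun i hi => ?_, fun i hi => ?_⟩
  · have hi' : (i : ℕ) + 1 ≤ ⌊t⌋₊ := by
      have := Fin.lt_def.1 hi
      simp only at this
      omega
    have hi'' : (i : ℝ) + 1 ≤ ⌊t⌋₊ := by exact_mod_cast hi'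
    rw [thresholdVec, min_eq_left (by linarith), max_eq_right zero_le_one]
  · have hi' : ⌊t⌋₊ + 1 ≤ (i : ℕ) := by
      have := Fin.lt_def.1 hi
      have := i.isLt
      simp only at *
      omega
    have hi'' : (⌊t⌋₊ : ℝ) + 1 ≤ i := by exact_mod_cast hi'
    have := Nat.lt_floor_add_one t
    rw [thresholdVec, max_eq_left ((min_le_right _ _).trans (by linarith))]

lemma continuous_simReward_thresholdVec {n : ℕ} (k : ℕ) (p v : Fin n → ℝ) :
    Continuous fun t => simReward k p v (thresholdVec n t) := by
  have := continuous_thresholdVec n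
  unfold simReward bernWeight
  fun_prop

/-- Moving expected mass to the front does not decrease the value collected. -/
lemma exists_thresholdVec_mass_eq {n : ℕ} (hn : 0 < n) {p v z : Fin n → ℝ}
    (hp : ∀ i, 0 ≤ p i) (hvmono : ∀ i j : Fin n, i ≤ j → v j ≤ v i)
    (hz : ∀ i, z i ∈ Set.Icc (0 : ℝ) 1) :
    ∃ t ∈ Set.Icc (0 : ℝ) n, ∑ i, thresholdVec n t i * p i = ∑ i, z i * p i ∧
      ∑ i, v i * (z i * p i) ≤ ∑ i, v i * (thresholdVec n t i * p i) := by
  have hcont : Continuous fun t => ∑ i, thresholdVec n t i * p i := by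
    have := continuous_thresholdVec n
    fun_prop
  have h0 : ∑ i, thresholdVec n 0 i * p i = 0 := by
    refine sum_eq_zero fun i _ => ?_
    rw [thresholdVec, max_eq_left ((min_le_right _ _).trans (by simp)), zero_mul]
  have hn1 : ∑ i, thresholdVec n n i * p i = ∑ i, p i := by
    refine sum_congr rfl fun i _ => ?_
    have hi : (i : ℝ) + 1 ≤ n := by exact_mod_cast i.isLt
    rw [thresholdVec, min_eq_left (by linarith), max_eq_right zero_le_one, one_mul]
  obtain ⟨t, ht, htm⟩ := intermediate_value_Icc (Nat.cast_nonneg n) hcont.continuousOn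
    (show ∑ i, z i * p i ∈ Set.Icc _ _ from by
      rw [h0, hn1]
      exact ⟨sum_nonneg fun i _ => mul_nonneg (hz i).1 (hp i),
        sum_le_sum fun i _ => mul_le_of_le_one_left (hp i) (hz i).2⟩)
  simp only at htm
  refine ⟨t, ht, htm, ?_⟩
  obtain ⟨j, hj1, hj0⟩ := exists_threshold_index hn ht
  have hterm : ∀ i, 0 ≤ (v i - v j) * ((thresholdVec n t i - z i) * p i) := by
    intro i
    rcases lt_trichotomy i j with h | rfl | h
    · rw [hj1 i h]
      exact mul_nonneg (sub_nonneg.2 (hvmono i j h.le))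
        (mul_nonneg (sub_nonneg.2 (hz i).2) (hp i))
    · simp
    · rw [hj0 i h]
      exact mul_nonneg_of_nonpos_of_nonpos (sub_nonpos.2 (hvmono j i h.le))
        (mul_nonpos_of_nonpos_of_nonneg (by linarith [(hz i).1]) (hp i))
  have hsum := sum_nonneg fun i (_ : i ∈ univ) => hterm i
  have hexp : ∑ i, (v i - v j) * ((thresholdVec n t i - z i) * p i) =
      (∑ i, v i * (thresholdVec n t i * p i) - ∑ i, v i * (z i * p i)) -
        v j * (∑ i, thresholdVec n t i * p i - ∑ i, z i * p i) := by
    rw [mul_sub, mul_sum, mul_sum, ← sum_sub_distrib, ← sum_sub_distrib, ← sum_sub_distrib]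
    exact sum_congr rfl fun i _ => by ring
  rw [hexp, htm] at hsum
  linarith

lemma exists_thresholdVec_reward_ge {n : ℕ} (hn : 0 < n) (k : ℕ) {p v y : Fin n → ℝ}
    (hp : ∀ i, p i ∈ Set.Icc (0 : ℝ) 1) (hvmono : ∀ i j : Fin n, i ≤ j → v j ≤ v i)
    (hy : ∀ i, y i ∈ Set.Icc (0 : ℝ) 1) {s : ℝ} (hs : s ∈ Set.Icc (0 : ℝ) 1) :
    ∃ t ∈ Set.Icc (0 : ℝ) n,
      s * ∑ i, v i * p i * y i - s * ∑ i, p i * y i + poisMin k (s * ∑ i, p i * y i) ≤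
        simReward k p v (thresholdVec n t) := by
  obtain ⟨t, ht, hm, hV⟩ := exists_thresholdVec_mass_eq hn (fun i => (hp i).1) hvmono
    (z := fun i => s * y i)
    fun i => ⟨mul_nonneg hs.1 (hy i).1, mul_le_one₀ hs.2 (hy i).1 (hy i).2⟩
  refine ⟨t, ht, ?_⟩
  have hexc := sum_bernWeight_mul_excess_le (fun i => thresholdVec n t i * p i)
    (fun i => ⟨mul_nonneg (thresholdVec_mem n t i).1 (hp i).1,
      mul_le_one₀ (thresholdVec_mem n t i).2 (hp i).1 (hp i).2⟩) k
  have hmass : ∑ i, s * y i * p i = s * ∑ i, p i * y i := by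
    rw [mul_sum]
    exact sum_congr rfl fun i _ => by ring
  have hval : ∑ i, v i * (s * y i * p i) = s * ∑ i, v i * p i * y i := by
    rw [mul_sum]
    exact sum_congr rfl fun i _ => by ring
  rw [hm, hmass] at hexc
  rw [hval] at hV
  unfold simReward
  linarith

lemma guarantee_le_of_mass_le {k : ℕ} (hk : 0 < k) {τ s m V : ℝ} (hτ : 0 < τ) (hs : 0 ≤ s)
    (hm : 0 ≤ m) (hmk : m ≤ k) (hV : τ * m ≤ V) :
    (s - s / τ + poisMin k (s * k) / (τ * k)) * V ≤ s * V - s * m + poisMin k (s * m) := by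
  have hk' : (0 : ℝ) < k := by exact_mod_cast hk
  have hle : poisMin k (s * k) ≤ s * k := by
    rw [poisMin_eq]
    linarith [le_poisShortfall_add k (mul_nonneg hs hk'.le)]
  have hconc := mul_poisMin_le (k := k) (c := m / k) (x := s * k)
    ⟨by positivity, (div_le_one hk').2 hmk⟩ (by positivity)
  rw [show m / k * (s * k) = s * m by field_simp] at hconc
  have hgap : 0 ≤ (s - poisMin k (s * k) / k) / τ :=
    div_nonneg (sub_nonneg.2 ((div_le_iff₀ hk').2 hle)) hτ.le
  have h := mul_le_mul_of_nonneg_left hV hgap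
  rw [show (s - poisMin k (s * k) / k) / τ * (τ * m) = s * m - m / k * poisMin k (s * k) by
    field_simp] at h
  rw [show s - s / τ + poisMin k (s * k) / (τ * k) = s - (s - poisMin k (s * k) / k) / τ by
    field_simp
    ring]
  linarith

lemma guarantee_le_of_le_mass {k : ℕ} (hk : 0 < k) {τ s m V : ℝ} (hτ : 0 < τ) (hs : 0 ≤ s)
    (hkm : k ≤ m) (hV : τ * k ≤ V + (k - m)) :
    (s - s / τ + poisMin k (s * k) / (τ * k)) * (V + (k - m)) ≤
      s * V - s * m + poisMin k (s * m) := by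
  have h := guarantee_le_of_mass_le hk hτ hs (Nat.cast_nonneg k) le_rfl hV
  have hk' : (0 : ℝ) ≤ k := Nat.cast_nonneg k
  have hmono : poisMin k (s * k) ≤ poisMin k (s * m) := by
    rw [poisMin_eq, poisMin_eq]
    exact sub_le_sub_left (antitoneOn_poisShortfall k (mul_nonneg hs hk')
      (mul_nonneg hs (hk'.trans hkm)) (mul_le_mul_of_nonneg_left hkm hs)) _
  linarith

lemma exists_thresholdVec_guarantee {n k : ℕ} (hn : 0 < n) (hk : 0 < k) {τ : ℝ} (hτ : 0 < τ)
    {p v y : Fin n → ℝ} (hp : ∀ i, p i ∈ Set.Icc (0 : ℝ) 1)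
    (hvmono : ∀ i j : Fin n, i ≤ j → v j ≤ v i) (hvτ : ∀ i, τ ≤ v i)
    (hy : ∀ i, y i ∈ Set.Icc (0 : ℝ) 1) {s : ℝ} (hs : s ∈ Set.Icc (0 : ℝ) 1)
    (ha : 0 ≤ s - s / τ + poisMin k (s * k) / (τ * k)) :
    ∃ t ∈ Set.Icc (0 : ℝ) n,
      (s - s / τ + poisMin k (s * k) / (τ * k)) *
          (∑ i, v i * p i * y i + min 0 ((k : ℝ) - ∑ i, p i * y i)) ≤
        simReward k p v (thresholdVec n t) := by
  have hk' : (0 : ℝ) < k := by exact_mod_cast hk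
  have hm : 0 ≤ ∑ i, p i * y i := sum_nonneg fun i _ => mul_nonneg (hp i).1 (hy i).1
  have hV : τ * ∑ i, p i * y i ≤ ∑ i, v i * p i * y i := by
    rw [mul_sum]
    refine sum_le_sum fun i _ => ?_
    rw [mul_assoc]
    exact mul_le_mul_of_nonneg_right (hvτ i) (mul_nonneg (hp i).1 (hy i).1)
  obtain ⟨t, ht, hR⟩ := exists_thresholdVec_reward_ge hn k hp hvmono hy hs
  rcases le_total (∑ i, p i * y i) k with hmk | hkm
  · refine ⟨t, ht, ?_⟩
    rw [min_eq_left (sub_nonneg.2 hmk), add_zero]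
    exact (guarantee_le_of_mass_le hk hτ hs.1 hm hmk hV).trans hR
  · rw [min_eq_right (sub_nonpos.2 hkm)]
    rcases le_total (τ * k) (∑ i, v i * p i * y i + ((k : ℝ) - ∑ i, p i * y i)) with hW | hW
    · exact ⟨t, ht, (guarantee_le_of_le_mass hk hτ hs.1 hkm hW).trans hR⟩
    · -- Shrinking `y` to expected mass exactly `k` improves the LP value here.
      have hm' := hk'.trans_le hkm
      set c : ℝ := k / ∑ i, p i * y i with hc
      have hc0 : 0 ≤ c := by positivity
      have hc1 : c ≤ 1 := (div_le_one hm').2 hkm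
      have hcm : c * ∑ i, p i * y i = k := div_mul_cancel₀ _ hm'.ne'
      obtain ⟨t, ht, hR⟩ := exists_thresholdVec_reward_ge hn k hp hvmono (y := fun i => c * y i)
        (fun i => ⟨mul_nonneg hc0 (hy i).1, mul_le_one₀ hc1 (hy i).1 (hy i).2⟩) hs
      refine ⟨t, ht, ?_⟩
      have hmass : ∑ i, p i * (c * y i) = k := by
        rw [← hcm, mul_sum]
        exact sum_congr rfl fun i _ => by ring
      have hval : τ * k ≤ ∑ i, v i * p i * (c * y i) := by
        have h := mul_le_mul_of_nonneg_left hV hc0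
        rw [show c * (τ * ∑ i, p i * y i) = τ * k by rw [← hcm]; ring, mul_sum] at h
        exact h.trans (le_of_eq (sum_congr rfl fun i _ => by ring))
      rw [hmass] at hR
      exact (mul_le_mul_of_nonneg_left (hW.trans hval) ha).trans
        ((guarantee_le_of_mass_le hk hτ hs.1 hk'.le le_rfl hval).trans hR)

/-- **Main guarantee for value-ordered policies (Theorem: simul_lower_bound).**
On any `τ`-bounded instance, there is a threshold vector `y'` whose induced randomized
value-ordered policy has expected simultaneous-offering reward at least
`α_k^τ · LP_sim`, where `α_k^τ = sup_{0 ≤ s ≤ 1} (s − s/τ + E[min(Pois(sk),k)]/(τk))`. -/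
theorem stmt11 (n k : ℕ) (hn : 0 < n) (hk : 0 < k)
    (τ : ℝ) (hτ : τ ∈ Set.Ioo (0:ℝ) 1)
    (p v : Fin n → ℝ) (hp : ∀ i, p i ∈ Set.Icc (0:ℝ) 1)
    (hvmono : ∀ i j : Fin n, i ≤ j → v j ≤ v i) (hvτ : ∀ i, τ ≤ v i) :
    ∃ y' : Fin n → ℝ,
      (∀ i, y' i ∈ Set.Icc (0:ℝ) 1) ∧
      (∃ j : Fin n, (∀ i, i < j → y' i = 1) ∧ ∀ i, j < i → y' i = 0) ∧
      (∑ i, v i * (y' i * p i))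
          - (∑ A : Finset (Fin n),
              bernWeight (fun i => y' i * p i) A * max ((A.card : ℝ) - (k:ℝ)) 0)
        ≥ sSup ((fun s : ℝ => s - s/τ + poisMin k (s*k) / (τ*k)) '' Set.Icc (0:ℝ) 1)
            * lpSim n k p v := by
  have hbox : (Set.Icc (0 : ℝ) n).Nonempty := Set.nonempty_Icc.2 (Nat.cast_nonneg n)
  obtain ⟨T, hT, hmax⟩ := isCompact_Icc.exists_isMaxOn hbox
    (continuous_simReward_thresholdVec k p v).continuousOn
  refine ⟨thresholdVec n T, thresholdVec_mem n T, exists_threshold_index hn hT, ?_⟩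
  change _ ≤ simReward k p v (thresholdVec n T)
  have hR : 0 ≤ simReward k p v (thresholdVec n T) := by
    obtain ⟨t, ht, h⟩ := exists_thresholdVec_reward_ge hn k hp hvmono
      (y := fun _ => 0) (fun _ => ⟨le_rfl, zero_le_one⟩) (s := 0) ⟨le_rfl, zero_le_one⟩
    have h' := h.trans (hmax ht)
    simpa [poisMin_eq, poisShortfall_zero] using h'
  have hbound : ∀ s ∈ Set.Icc (0 : ℝ) 1,
      (s - s / τ + poisMin k (s * k) / (τ * k)) * lpSim n k p v ≤
        simReward k p v (thresholdVec n T) := by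
    intro s hs
    have hlp : 0 ≤ lpSim n k p v :=
      Real.sSup_nonneg' ⟨0, ⟨fun _ => 0, fun _ => ⟨le_rfl, zero_le_one⟩, by simp⟩, le_rfl⟩
    rcases le_or_gt (s - s / τ + poisMin k (s * k) / (τ * k)) 0 with ha | ha
    · exact (mul_nonpos_of_nonpos_of_nonneg ha hlp).trans hR
    · rw [mul_comm, ← le_div_iff₀ ha]
      refine csSup_le ⟨_, fun _ => 0, fun _ => ⟨le_rfl, zero_le_one⟩, rfl⟩ ?_
      rintro _ ⟨y, hy, rfl⟩
      obtain ⟨t, ht, h⟩ := exists_thresholdVec_guarantee hn hk hτ.1 hp hvmono hvτ hy hs ha.le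
      rw [le_div_iff₀ ha, mul_comm]
      exact h.trans (hmax ht)
  rcases le_or_gt (lpSim n k p v) 0 with hlp | hlp
  · have hα : 0 ≤ sSup ((fun s : ℝ => s - s / τ + poisMin k (s * k) / (τ * k)) ''
        Set.Icc (0 : ℝ) 1) :=
      Real.sSup_nonneg' ⟨0, ⟨0, by simp, by simp [poisMin_eq, poisShortfall_zero]⟩, le_rfl⟩
    exact (mul_nonpos_of_nonneg_of_nonpos hα hlp).trans hR
  · rw [← le_div_iff₀ hlp]
    refine csSup_le (Set.Nonempty.image _ (Set.nonempty_Icc.2 zero_le_one)) ?_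
    rintro _ ⟨s, hs, rfl⟩
    exact (le_div_iff₀ hlp).2 (hbound s hs)
end

section
/- For every integer k ≥ 1, Σ_{j=0}^∞ min(j, k) e^{−k} k^j / j! = k · (1 − e^{−k} k^k / k!). -/
/-- The partial sums of `(x - j) x ^ j / j!` telescope. -/
theorem sum_range_sub_mul_pow_div_factorial (x : ℝ) (n : ℕ) :
    ∑ j ∈ Finset.range n, (x - j) * (x ^ j / (Nat.factorial j : ℝ))
      = n * (x ^ n / (Nat.factorial n : ℝ)) := by
  induction n with
  | zero => simp
  | succ n ih =>
    rw [Finset.sum_range_succ, ih, Nat.factorial_succ]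
    have hn : (Nat.factorial n : ℝ) ≠ 0 := by positivity
    push_cast
    field_simp
    ring

/-- The positive part of `k - X`, for `X` Poisson with mean `k`, has mean
`k * exp (-k) * k ^ k / k!`. -/
theorem hasSum_sub_min_mul_poisson (k : ℕ) :
    HasSum (fun j : ℕ => ((k : ℝ) - min (j : ℝ) k) *
        (Real.exp (-(k : ℝ)) * (k : ℝ) ^ j / (Nat.factorial j : ℝ)))
      (k * (Real.exp (-(k : ℝ)) * (k : ℝ) ^ k / (Nat.factorial k : ℝ))) := by
  have hsum : ∑ j ∈ Finset.range k, ((k : ℝ) - min (j : ℝ) k) *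
        (Real.exp (-(k : ℝ)) * (k : ℝ) ^ j / (Nat.factorial j : ℝ))
      = k * (Real.exp (-(k : ℝ)) * (k : ℝ) ^ k / (Nat.factorial k : ℝ)) := by
    rw [mul_div_assoc, mul_left_comm, ← sum_range_sub_mul_pow_div_factorial, Finset.mul_sum]
    refine Finset.sum_congr rfl fun j hj => ?_
    rw [min_eq_left (Nat.cast_le.2 (Finset.mem_range.1 hj).le)]
    ring
  rw [← hsum]
  refine hasSum_sum_of_ne_finset_zero fun j hj => ?_
  rw [min_eq_right (Nat.cast_le.2 (not_lt.1 (mt Finset.mem_range.2 hj))), sub_self, zero_mul]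

/-- The Poisson weights with real parameter `x` sum to one. -/
theorem hasSum_exp_neg_mul_pow_div_factorial (x : ℝ) :
    HasSum (fun j : ℕ => Real.exp (-x) * x ^ j / (Nat.factorial j : ℝ)) 1 := by
  have h := (NormedSpace.expSeries_div_hasSum_exp x).mul_left (Real.exp (-x))
  rw [← Real.exp_eq_exp_ℝ, ← Real.exp_add, neg_add_cancel, Real.exp_zero] at h
  simpa only [mul_div_assoc] using h

/-- **`E[min(Pois(k), k)] = k (1 − e^{−k} k^k / k!)` (tightness of the ProbeTop-k guarantee).** -/
theorem stmt15 (k : ℕ) (hk : 0 < k) :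
    ∑' j : ℕ, min (j : ℝ) (k : ℝ) * (Real.exp (-(k:ℝ)) * (k:ℝ)^j / (Nat.factorial j : ℝ))
      = (k:ℝ) * (1 - Real.exp (-(k:ℝ)) * (k:ℝ)^k / (Nat.factorial k : ℝ)) := by
  rw [mul_sub, ← (((hasSum_exp_neg_mul_pow_div_factorial (k : ℝ)).mul_left (k : ℝ)).sub
    (hasSum_sub_min_mul_poisson k)).tsum_eq]
  exact tsum_congr fun j => by ring
end
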